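/- Let n be a positive integer, let M be a real symmetric positive definite n×n matrix with largest eigenvalue λ_max satisfying λ_max · n < 1, and let k₁, k₂ ∈ ℝ^n each have every coordinate in [0,1]. Then ‖ k₁ / (1 − k₁ᵀ M k₁)^{1/2} − k₂ / (1 − k₂ᵀ M k₂)^{1/2} ‖ ≤ (1 − λ_max n)^{-3/2} · ‖k₁ − k₂‖. -/

import Mathlib

open scoped RealInnerProductSpace

/-- A positive semidefinite matrix all of whose eigenvalues are at most `l` has Euclidean operator
norm at most `l`. -/
lemma Matrix.PosSemidef.norm_toEuclideanLin_le {ι : Type*} [Fintype ι] [DecidableEq ι]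
    {M : Matrix ι ι ℝ} (hM : M.PosSemidef) {l : ℝ} (hl : ∀ i, hM.isHermitian.eigenvalues i ≤ l)
    (hl0 : 0 ≤ l) (x : EuclideanSpace ℝ ι) :
    ‖Matrix.toEuclideanLin M x‖ ≤ l * ‖x‖ := by
  set b := hM.isHermitian.eigenvectorBasis
  have hsymm := Matrix.isSymmetric_toEuclideanLin_iff.mpr hM.isHermitian
  have hb (i : ι) : Matrix.toEuclideanLin M (b i) = hM.isHermitian.eigenvalues i • b i := by
    ext j
    exact congrFun (hM.isHermitian.mulVec_eigenvectorBasis i) j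
  refine le_of_sq_le_sq ?_ (by positivity)
  rw [mul_pow, ← b.sum_sq_norm_inner_right, ← b.sum_sq_norm_inner_right x, Finset.mul_sum]
  refine Finset.sum_le_sum fun i _ => ?_
  rw [← hsymm (b i) x, hb, real_inner_smul_left, norm_mul, mul_pow, Real.norm_eq_abs, sq_abs]
  have := hM.eigenvalues_nonneg i
  gcongr
  exact hl i

/-- On the ball of radius `√r`, the map `x ↦ x / √(1 - ⟪x, T x⟫)` is Lipschitz with constant
`(1 - l r)^(-3/2)` when `T` is symmetric with norm at most `l` and `l r < 1`. -/
lemma LinearMap.IsSymmetric.norm_inv_sqrt_smul_sub_le {E : Type*} [NormedAddCommGroup E]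
    [InnerProductSpace ℝ E] {T : E →ₗ[ℝ] E} (hT : T.IsSymmetric) {l r : ℝ} (hl : 0 ≤ l)
    (hTl : ∀ x, ‖T x‖ ≤ l * ‖x‖) (hlr : l * r < 1) {x y : E} (hx : ‖x‖ ^ 2 ≤ r)
    (hy : ‖y‖ ^ 2 ≤ r) :
    ‖(√(1 - ⟪x, T x⟫))⁻¹ • x - (√(1 - ⟪y, T y⟫))⁻¹ • y‖ ≤
      (1 - l * r) ^ (-(3 / 2) : ℝ) * ‖x - y‖ := by
  have hc : 0 < 1 - l * r := by linarith
  have hq {z : E} (hz : ‖z‖ ^ 2 ≤ r) : ⟪z, T z⟫ ≤ l * r := calc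
    ⟪z, T z⟫ ≤ ‖z‖ * ‖T z‖ := real_inner_le_norm _ _
    _ ≤ ‖z‖ * (l * ‖z‖) := by gcongr; exact hTl z
    _ = l * ‖z‖ ^ 2 := by ring
    _ ≤ l * r := by gcongr
  set s := √(1 - l * r) with hs
  set a := √(1 - ⟪x, T x⟫) with ha
  set b := √(1 - ⟪y, T y⟫) with hb
  have hs0 : 0 < s := Real.sqrt_pos.mpr hc
  have hsa : s ≤ a := Real.sqrt_le_sqrt (by linarith [hq hx])
  have hsb : s ≤ b := Real.sqrt_le_sqrt (by linarith [hq hy])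
  have ha0 : 0 < a := hs0.trans_le hsa
  have hb0 : 0 < b := hs0.trans_le hsb
  have hs2 : s ^ 2 = 1 - l * r := Real.sq_sqrt hc.le
  have ha2 : a ^ 2 = 1 - ⟪x, T x⟫ := Real.sq_sqrt (by linarith [hq hx])
  have hb2 : b ^ 2 = 1 - ⟪y, T y⟫ := Real.sq_sqrt (by linarith [hq hy])
  have hdiff : b ^ 2 - a ^ 2 = ⟪x - y, T (x + y)⟫ := by
    have h : ⟪y, T x⟫ = ⟪x, T y⟫ := by rw [← hT y x, real_inner_comm]
    rw [ha2, hb2, map_add, inner_sub_left, inner_add_right, inner_add_right, h]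
    ring
  have hxy : ‖x + y‖ * ‖y‖ ≤ 2 * r := by
    nlinarith [norm_add_le x y, norm_nonneg y, sq_nonneg (‖x‖ - ‖y‖)]
  have habs : |b ^ 2 - a ^ 2| * ‖y‖ ≤ 2 * (l * r) * ‖x - y‖ := calc
    |b ^ 2 - a ^ 2| * ‖y‖ ≤ ‖x - y‖ * (l * ‖x + y‖) * ‖y‖ := by
      rw [hdiff]
      gcongr
      exact (abs_real_inner_le_norm _ _).trans (by gcongr; exact hTl _)
    _ = l * ‖x - y‖ * (‖x + y‖ * ‖y‖) := by ring
    _ ≤ l * ‖x - y‖ * (2 * r) := by gcongr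
    _ = 2 * (l * r) * ‖x - y‖ := by ring
  have hr : 0 ≤ r := (sq_nonneg _).trans hx
  have hinv : |a⁻¹ - b⁻¹| * ‖y‖ ≤ (l * r) / s ^ 3 * ‖x - y‖ := calc
    |a⁻¹ - b⁻¹| * ‖y‖ = |b ^ 2 - a ^ 2| * ‖y‖ / (a * b * (a + b)) := by
      rw [show a⁻¹ - b⁻¹ = (b ^ 2 - a ^ 2) / (a * b * (a + b)) by field_simp; ring, abs_div,
        abs_of_pos (show 0 < a * b * (a + b) by positivity)]
      ring
    _ ≤ 2 * (l * r) * ‖x - y‖ / (s * s * (s + s)) := by gcongr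
    _ = (l * r) / s ^ 3 * ‖x - y‖ := by field_simp; ring
  have hpow : (1 - l * r) ^ (-(3 / 2) : ℝ) = (s ^ 3)⁻¹ := by
    rw [Real.rpow_neg hc.le, hs, Real.sqrt_eq_rpow, ← Real.rpow_mul_natCast hc.le]
    norm_num
  calc ‖a⁻¹ • x - b⁻¹ • y‖ = ‖a⁻¹ • (x - y) + (a⁻¹ - b⁻¹) • y‖ := by
        congr 1; module
    _ ≤ a⁻¹ * ‖x - y‖ + |a⁻¹ - b⁻¹| * ‖y‖ := by
        refine (norm_add_le _ _).trans_eq ?_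
        rw [norm_smul, norm_smul, Real.norm_eq_abs, Real.norm_eq_abs,
          abs_of_pos (inv_pos.mpr ha0)]
    _ ≤ s⁻¹ * ‖x - y‖ + (l * r) / s ^ 3 * ‖x - y‖ := by gcongr
    _ = (1 - l * r) ^ (-(3 / 2) : ℝ) * ‖x - y‖ := by
        rw [hpow, show l * r = 1 - s ^ 2 by linarith]
        field_simp
        ring

/-- A vector of the unit cube has squared Euclidean norm at most the dimension. -/
lemma EuclideanSpace.norm_sq_le_card {ι : Type*} [Fintype ι] {x : EuclideanSpace ℝ ι}
    (hx : ∀ i, x i ∈ Set.Icc (0 : ℝ) 1) : ‖x‖ ^ 2 ≤ Fintype.card ι := by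
  rw [EuclideanSpace.real_norm_sq_eq]
  calc ∑ i, x i ^ 2 ≤ ∑ _i : ι, (1 : ℝ) :=
        Finset.sum_le_sum fun i _ => pow_le_one₀ (hx i).1 (hx i).2
    _ = Fintype.card ι := by simp

lemma Matrix.inner_toEuclideanLin_self {ι : Type*} [Fintype ι] [DecidableEq ι]
    (M : Matrix ι ι ℝ) (x : EuclideanSpace ℝ ι) :
    ⟪x, Matrix.toEuclideanLin M x⟫ = ∑ i, ∑ j, x i * M i j * x j := by
  simp [PiLp.inner_apply, Matrix.toLpLin_apply, Matrix.mulVec, dotProduct, mul_comm,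
    Finset.mul_sum, mul_assoc, mul_left_comm]


/-- The core estimate in Lemma 2 of the paper: for a real symmetric positive
definite `n × n` matrix `M` with largest eigenvalue `lammax` satisfying
`lammax * n < 1`, and `k₁, k₂ ∈ [0,1]^n`,
`‖k₁/(1 − k₁ᵀMk₁)^{1/2} − k₂/(1 − k₂ᵀMk₂)^{1/2}‖ ≤ (1 − lammax n)^{-3/2} ‖k₁ − k₂‖`. -/
theorem normalized_vec_diff_bound (n : ℕ) (hn : 0 < n)
    (M : Matrix (Fin n) (Fin n) ℝ) (hM : M.PosDef) (lammax : ℝ)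
    (hub : ∀ (μ : ℝ) (v : Fin n → ℝ), v ≠ 0 → M.mulVec v = μ • v → μ ≤ lammax)
    (hmem : ∃ v : Fin n → ℝ, v ≠ 0 ∧ M.mulVec v = lammax • v)
    (hsmall : lammax * n < 1)
    (k₁ k₂ : EuclideanSpace ℝ (Fin n))
    (hk₁ : ∀ i, k₁ i ∈ Set.Icc (0 : ℝ) 1) (hk₂ : ∀ i, k₂ i ∈ Set.Icc (0 : ℝ) 1) :
    ‖(Real.sqrt (1 - ∑ i, ∑ j, k₁ i * M i j * k₁ j))⁻¹ • k₁ -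
        (Real.sqrt (1 - ∑ i, ∑ j, k₂ i * M i j * k₂ j))⁻¹ • k₂‖ ≤
      (1 - lammax * n) ^ (-(3 / 2) : ℝ) * ‖k₁ - k₂‖ := by
  have heig (i : Fin n) : hM.posSemidef.isHermitian.eigenvalues i ≤ lammax :=
    hub _ _ (fun h => hM.isHermitian.eigenvectorBasis.orthonormal.ne_zero i
      ((WithLp.ofLp_eq_zero 2).mp h)) (hM.isHermitian.mulVec_eigenvectorBasis i)
  have hl : 0 ≤ lammax := (hM.posSemidef.eigenvalues_nonneg ⟨0, hn⟩).trans (heig _)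
  have hnorm {k : EuclideanSpace ℝ (Fin n)} (hk : ∀ i, k i ∈ Set.Icc (0 : ℝ) 1) :
      ‖k‖ ^ 2 ≤ n := by
    simpa using EuclideanSpace.norm_sq_le_card hk
  rw [← Matrix.inner_toEuclideanLin_self, ← Matrix.inner_toEuclideanLin_self]
  exact (Matrix.isSymmetric_toEuclideanLin_iff.mpr hM.isHermitian).norm_inv_sqrt_smul_sub_le hl
    (hM.posSemidef.norm_toEuclideanLin_le heig hl) hsmall (hnorm hk₁) (hnorm hk₂)
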